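/- arXiv:1607.01974 — 5 statements merged into one kernel-verified Lean document; each statement's English description precedes it below -/
import Mathlib

section
/- Let p ∈ (0,1/2), and consider the four edges e₀, e₁, e₂, e₃ of a unit square with corners v₀, v₁, v₂, v₃, where e_i = {v_i, v_{i+1 mod 4}}. There exists a probability measure P on {0,1}^{4} × {0,1}^{4} (pairs (ω, ω̃) of configurations of the four edges) such that: (i) the first marginal of P is the product Bernoulli measure Ber(p)^{⊗4} and the second marginal is Ber(1−p)^{⊗4}; (ii) P-almost surely, either ω̃ = ω or ω̃ is the complementary configuration 1−ω; (iii) P-almost surely, whenever ω̃ = 1−ω ≠ ω one has Σ_i ω(e_i) ≤ 1; consequently, P-almost surely any two corners of the square joined by a path of ω-open edges are joined by a path of ω̃-open edges, and the degree of each corner (ω(e_{i−1 mod 4}) + ω(e_i) for corner v_i) has the same parity in ω and in ω̃. -/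
open MeasureTheory
open scoped BigOperators

noncomputable section

/-- A configuration of the four edges `e₀, e₁, e₂, e₃` of the unit square
(`e_i` joins the corners `v_i` and `v_{i+1 mod 4}`); `true` = open. -/
abbrev SqConfig : Type := Fin 4 → Bool

/-- The flipped (complementary) configuration `1 - ω`. -/
def sqFlip (ω : SqConfig) : SqConfig := fun i => !(ω i)

/-- Number of open edges. -/
def sqCard (ω : SqConfig) : ℕ := (Finset.univ.filter (fun i : Fin 4 => ω i = true)).card

/-- The corners `v_i` and `v_j` are connected in `ω`: reflexive-transitive closure of
being joined by an open edge (the edge `e_i` joins `v_i` and `v_{i+1}`). -/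
def sqConn (ω : SqConfig) : Fin 4 → Fin 4 → Prop :=
  Relation.ReflTransGen (fun i j => (ω i = true ∧ j = i + 1) ∨ (ω j = true ∧ i = j + 1))

/-- The degree of the corner `v_i` in `ω`: the corner `v_i` is incident to the edges
`e_{i-1}` and `e_i`. -/
def sqDeg (ω : SqConfig) (i : Fin 4) : ℕ :=
  (if ω (i - 1) = true then 1 else 0) + (if ω i = true then 1 else 0)

theorem sqFlip_sqFlip (ω : SqConfig) : sqFlip (sqFlip ω) = ω := by
  funext i
  simp [sqFlip]

theorem sqFlip_eq_iff (ω η : SqConfig) : sqFlip ω = η ↔ ω = sqFlip η :=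
  ⟨fun h => by rw [← h, sqFlip_sqFlip], fun h => by rw [h, sqFlip_sqFlip]⟩

theorem sqDeg_sqFlip_mod_two (ω : SqConfig) (i : Fin 4) :
    sqDeg ω i % 2 = sqDeg (sqFlip ω) i % 2 := by
  cases h : ω (i - 1) <;> cases h' : ω i <;> simp [sqDeg, sqFlip, h, h']

theorem sqConn_symm {ω : SqConfig} {i j : Fin 4} (h : sqConn ω i j) : sqConn ω j i :=
  (@Relation.ReflTransGen.stdSymm _ _ ⟨fun _ _ hxy => hxy.symm⟩).symm _ _ h

/-- Opening all edges of the square but one connects all the corners. -/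
theorem sqConn_of_forall_ne {ω : SqConfig} {k : Fin 4} (hω : ∀ i, i ≠ k → ω i = true)
    (i j : Fin 4) : sqConn ω i j := by
  have h1 : sqConn ω (k + 1) (k + 1) := Relation.ReflTransGen.refl
  have h2 : sqConn ω (k + 1) (k + 1 + 1) :=
    h1.tail (Or.inl ⟨hω _ (by clear * -; revert k; decide), rfl⟩)
  have h3 : sqConn ω (k + 1) (k + 1 + 1 + 1) :=
    h2.tail (Or.inl ⟨hω _ (by clear * -; revert k; decide), rfl⟩)
  have h4 : sqConn ω (k + 1) (k + 1 + 1 + 1 + 1) :=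
    h3.tail (Or.inl ⟨hω _ (by clear * -; revert k; decide), rfl⟩)
  have key : ∀ l, sqConn ω (k + 1) l := by
    intro l
    have hl : l = k + 1 ∨ l = k + 1 + 1 ∨ l = k + 1 + 1 + 1 ∨ l = k + 1 + 1 + 1 + 1 := by
      clear * -
      revert k l
      decide
    rcases hl with rfl | rfl | rfl | rfl <;> assumption
  exact (sqConn_symm (key i)).trans (key j)

theorem sqConn_sqFlip_of_sqCard_le_one {ω : SqConfig} (h : sqCard ω ≤ 1) (i j : Fin 4) :
    sqConn (sqFlip ω) i j := by
  obtain ⟨k, hk⟩ := Finset.card_le_one_iff_subset_singleton.1 h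
  refine sqConn_of_forall_ne (k := k) (fun l hl => ?_) i j
  by_contra hc
  exact hl (Finset.mem_singleton.1 (hk (by simpa [sqFlip] using hc)))

/-- The mass of `ω` under the product Bernoulli measure of parameter `q`. -/
def sqWeight (q : ℝ) (ω : SqConfig) : ℝ := ∏ i : Fin 4, if ω i then q else 1 - q

theorem sqWeight_nonneg {q : ℝ} (h0 : 0 ≤ q) (h1 : q ≤ 1) (ω : SqConfig) : 0 ≤ sqWeight q ω :=
  Finset.prod_nonneg fun i _ => by split_ifs <;> linarith

theorem sum_sqWeight (q : ℝ) : ∑ ω, sqWeight q ω = 1 := by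
  have h := Finset.prod_univ_sum (fun _ : Fin 4 => (Finset.univ : Finset Bool))
    (fun _ b => if b then q else 1 - q)
  rw [Fintype.piFinset_univ] at h
  simpa [sqWeight] using h.symm

theorem sqWeight_sqFlip (q : ℝ) (ω : SqConfig) :
    sqWeight q (sqFlip ω) = ∏ i : Fin 4, if ω i then 1 - q else q :=
  Finset.prod_congr rfl fun i _ => by cases h : ω i <;> simp [sqFlip, h]

theorem sqCard_le_one_of_sqWeight_lt {p : ℝ} (hp0 : 0 < p) (hp1 : p < 1 / 2) {ω : SqConfig}
    (h : sqWeight p (sqFlip ω) < sqWeight p ω) : sqCard ω ≤ 1 := by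
  have hc := Finset.card_filter_add_card_filter_not (s := (Finset.univ : Finset (Fin 4)))
    (fun i => ω i = true)
  rw [sqWeight_sqFlip, sqWeight] at h
  simp only [Finset.prod_ite, Finset.prod_const] at h
  unfold sqCard
  generalize (Finset.univ.filter fun i => ω i = true).card = m at *
  generalize (Finset.univ.filter fun i => ¬ω i = true).card = n at *
  by_contra hm
  simp only [Finset.card_univ, Fintype.card_fin] at hc
  obtain ⟨d, rfl⟩ : ∃ d, m = n + d := ⟨m - n, by omega⟩
  have hd : p ^ d ≤ (1 - p) ^ d := pow_le_pow_left₀ hp0.le (by linarith) d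
  have hn : 0 ≤ p ^ n * (1 - p) ^ n := mul_nonneg (by positivity) (pow_nonneg (by linarith) n)
  have := mul_le_mul_of_nonneg_left hd hn
  rw [pow_add, pow_add] at h
  linarith

/-- The coupling which flips `ω` exactly as often as needed to transport the excess of its mass
over that of its complement. -/
def sqCoupling (p : ℝ) : Measure (SqConfig × SqConfig) :=
  ∑ ω : SqConfig,
    (ENNReal.ofReal (min (sqWeight p ω) (sqWeight p (sqFlip ω))) • Measure.dirac (ω, ω) +
      ENNReal.ofReal (sqWeight p ω - sqWeight p (sqFlip ω)) • Measure.dirac (ω, sqFlip ω))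

theorem ofReal_min_add_ofReal_sub {x y : ℝ} (hy : 0 ≤ y) :
    ENNReal.ofReal (min x y) + ENNReal.ofReal (x - y) = ENNReal.ofReal x := by
  rcases le_total x y with h | h
  · rw [min_eq_left h, ENNReal.ofReal_of_nonpos (sub_nonpos.2 h), add_zero]
  · rw [min_eq_right h, ← ENNReal.ofReal_add hy (sub_nonneg.2 h), add_sub_cancel]

theorem sqCoupling_apply (p : ℝ) (S : Set (SqConfig × SqConfig)) :
    sqCoupling p S = ∑ ω : SqConfig,
      (ENNReal.ofReal (min (sqWeight p ω) (sqWeight p (sqFlip ω))) * S.indicator 1 (ω, ω) +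
        ENNReal.ofReal (sqWeight p ω - sqWeight p (sqFlip ω)) *
          S.indicator 1 (ω, sqFlip ω)) := by
  simp [sqCoupling, Measure.finsetSum_apply, Measure.dirac_apply]

theorem isProbabilityMeasure_sqCoupling {p : ℝ} (h0 : 0 ≤ p) (h1 : p ≤ 1) :
    IsProbabilityMeasure (sqCoupling p) := by
  refine ⟨?_⟩
  simp only [sqCoupling_apply, Set.indicator_univ, Pi.one_apply, mul_one,
    ofReal_min_add_ofReal_sub (sqWeight_nonneg h0 h1 _)]
  rw [← ENNReal.ofReal_sum_of_nonneg fun ω _ => sqWeight_nonneg h0 h1 ω, sum_sqWeight,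
    ENNReal.ofReal_one]

theorem sqCoupling_map_fst {p : ℝ} (h0 : 0 ≤ p) (h1 : p ≤ 1) (ω : SqConfig) :
    (sqCoupling p).map Prod.fst {ω} = ENNReal.ofReal (sqWeight p ω) := by
  classical
  rw [Measure.map_apply measurable_fst (MeasurableSet.singleton ω), sqCoupling_apply]
  simp only [Set.indicator_apply, Set.mem_preimage, Set.mem_singleton_iff, Pi.one_apply, mul_ite,
    mul_one, mul_zero, Finset.sum_add_distrib, Finset.sum_ite_eq', Finset.mem_univ, if_true]
  exact ofReal_min_add_ofReal_sub (sqWeight_nonneg h0 h1 _)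

theorem sqCoupling_map_snd {p : ℝ} (h0 : 0 ≤ p) (h1 : p ≤ 1) (ω : SqConfig) :
    (sqCoupling p).map Prod.snd {ω} = ENNReal.ofReal (sqWeight p (sqFlip ω)) := by
  classical
  rw [Measure.map_apply measurable_snd (MeasurableSet.singleton ω), sqCoupling_apply]
  simp only [Set.indicator_apply, Set.mem_preimage, Set.mem_singleton_iff, Pi.one_apply, mul_ite,
    mul_one, mul_zero, Finset.sum_add_distrib, sqFlip_eq_iff, Finset.sum_ite_eq',
    Finset.mem_univ, if_true, sqFlip_sqFlip]
  rw [min_comm]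
  exact ofReal_min_add_ofReal_sub (sqWeight_nonneg h0 h1 _)

/-- The coupling is carried by the pairs `(ω, ω)` and the pairs `(ω, sqFlip ω)` in which `ω` has
at most one open edge. -/
theorem sqCoupling_eq_one {p : ℝ} (hp0 : 0 < p) (hp1 : p < 1 / 2)
    {S : Set (SqConfig × SqConfig)} (hdiag : ∀ ω, (ω, ω) ∈ S)
    (hflip : ∀ ω, sqCard ω ≤ 1 → (ω, sqFlip ω) ∈ S) : sqCoupling p S = 1 := by
  have := isProbabilityMeasure_sqCoupling hp0.le (by linarith : p ≤ 1)
  rw [← measure_univ (μ := sqCoupling p), sqCoupling_apply, sqCoupling_apply]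
  refine Finset.sum_congr rfl fun ω _ => ?_
  rcases lt_or_ge (sqWeight p (sqFlip ω)) (sqWeight p ω) with h | h
  · simp [hdiag ω, hflip ω (sqCard_le_one_of_sqWeight_lt hp0 hp1 h)]
  · simp [hdiag ω, ENNReal.ofReal_of_nonpos (sub_nonpos.2 h)]

/-- For `p ∈ (0, 1/2)` there is a coupling `P` of `Ber(p)^{⊗4}` and `Ber(1-p)^{⊗4}` on
the four edges of the unit square such that almost surely the second configuration is
either equal to the first one or its complement, the complement case only occurs when at
most one edge is open in the first configuration; consequently, almost surely the second
configuration is more connected than the first one and the degrees of the corners have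
the same parities in both configurations. -/
theorem square_coupling_exists (p : ℝ) (hp0 : 0 < p) (hp1 : p < 1 / 2) :
    ∃ P : Measure (SqConfig × SqConfig), IsProbabilityMeasure P ∧
      (∀ a : SqConfig,
        P.map Prod.fst {a} = ENNReal.ofReal (∏ i : Fin 4, if a i then p else 1 - p)) ∧
      (∀ a : SqConfig,
        P.map Prod.snd {a} = ENNReal.ofReal (∏ i : Fin 4, if a i then 1 - p else p)) ∧
      P {ωp : SqConfig × SqConfig | ωp.2 = ωp.1 ∨ ωp.2 = sqFlip ωp.1} = 1 ∧
      P {ωp : SqConfig × SqConfig |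
          ωp.2 = sqFlip ωp.1 ∧ sqFlip ωp.1 ≠ ωp.1 → sqCard ωp.1 ≤ 1} = 1 ∧
      P {ωp : SqConfig × SqConfig | ∀ i j : Fin 4, sqConn ωp.1 i j → sqConn ωp.2 i j} = 1 ∧
      P {ωp : SqConfig × SqConfig | ∀ i : Fin 4, sqDeg ωp.1 i % 2 = sqDeg ωp.2 i % 2} = 1 := by
  refine ⟨sqCoupling p, isProbabilityMeasure_sqCoupling hp0.le (by linarith),
    fun a => sqCoupling_map_fst hp0.le (by linarith) a, fun a => ?_,
    sqCoupling_eq_one hp0 hp1 (fun _ => Or.inl rfl) (fun _ _ => Or.inr rfl),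
    sqCoupling_eq_one hp0 hp1 (fun _ h => absurd h.1.symm h.2) (fun _ hω _ => hω),
    sqCoupling_eq_one hp0 hp1 (fun _ _ _ h => h)
      (fun _ hω i j _ => sqConn_sqFlip_of_sqCard_le_one hω i j),
    sqCoupling_eq_one hp0 hp1 (fun _ _ => rfl) (fun ω _ i => sqDeg_sqFlip_mod_two ω i)⟩
  rw [sqCoupling_map_snd hp0.le (by linarith), sqWeight_sqFlip]

end
end

section
/- Let η ∈ Ω_EP be an even edge configuration on Z². For any two dual sites x_*, y_* ∈ Z²_* and any two nearest-neighbour paths in Z²_* from x_* to y_*, the number of η-open edges of E₂ crossed by the first path and the number crossed by the second path have the same parity (an edge of a dual path crosses the edge e ∈ E₂ whose dual is that edge, and crossings are counted with multiplicity along the path). -/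
open MeasureTheory
open scoped BigOperators

noncomputable section

/-- Vertices of the square lattice `ℤ²`. -/
abbrev V : Type := ℤ × ℤ

/-- Nearest-neighbour adjacency on `ℤ²` (`ℓ¹`-distance one). -/
def latAdj (x y : V) : Prop := |x.1 - y.1| + |x.2 - y.2| = 1

/-- The edge set `E₂` of the square lattice, as a set of unordered pairs of vertices. -/
def E2 : Set (Sym2 V) := {e | ∃ x y : V, latAdj x y ∧ e = s(x, y)}

abbrev Edge : Type := ↥E2

/-- An edge configuration: an element of `{0,1}^{E₂}` (`true` = open). -/
abbrev Config : Type := Edge → Bool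

/-- The four unit directions. -/
def dir : Fin 4 → V := ![(1, 0), (-1, 0), (0, 1), (0, -1)]

lemma latAdj_dir (x : V) (d : Fin 4) : latAdj x (x + dir d) := by
  fin_cases d <;> simp [latAdj, dir, Prod.fst_add, Prod.snd_add]

/-- The edge from `x` in direction `d`, as an element of `E₂`. -/
def incEdge (x : V) (d : Fin 4) : Edge :=
  ⟨s(x, x + dir d), ⟨x, x + dir d, latAdj_dir x d, rfl⟩⟩

/-- The vertex `x` has even degree in the configuration `ω` (the four incident edges
of `x` are `incEdge x d`, `d : Fin 4`, each counted once). -/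
def degEven (ω : Config) (x : V) : Prop :=
  Even ((Finset.univ.filter (fun d : Fin 4 => ω (incEdge x d) = true)).card)

/-- The set `Ω_EP` of even (Eulerian) configurations. -/
def ΩEP : Set Config := {ω | ∀ x : V, degEven ω x}

/-- The primal edge crossed by the dual step from dual site `a` to dual site `b`
(dual sites in dual coordinates: `u` stands for `u + (1/2,1/2)`). -/
def crossEdge (a b : V) : Sym2 V :=
  let M : V := (a.1 ⊔ b.1, a.2 ⊔ b.2)
  if a.2 = b.2 then s(M, (M.1, M.2 + 1)) else s(M, (M.1 + 1, M.2))

lemma crossEdge_mem (a b : V) : crossEdge a b ∈ E2 := by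
  unfold crossEdge
  by_cases h : a.2 = b.2
  · rw [if_pos h]
    exact ⟨_, _, by simp [latAdj], rfl⟩
  · rw [if_neg h]
    exact ⟨_, _, by simp [latAdj], rfl⟩

/-- The number of `η`-open edges of `E₂` crossed by the dual path `γ` (counted with
multiplicity along the path). -/
def crossCount (η : Config) (n : ℕ) (γ : Fin (n + 1) → V) : ℕ :=
  ∑ i : Fin n,
    if η ⟨crossEdge (γ i.castSucc) (γ i.succ), crossEdge_mem _ _⟩ = true then 1 else 0

/-- Every function on `ℤ` has a discrete antiderivative. -/
lemma exists_discrete_antiderivative {G : Type*} [AddCommGroup G] (f : ℤ → G) :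
    ∃ F : ℤ → G, F 0 = 0 ∧ ∀ i, F (i + 1) = F i + f i := by
  refine ⟨fun n => ∑ k ∈ Finset.Ico 0 n, f k - ∑ k ∈ Finset.Ico n 0, f k, by simp, fun i => ?_⟩
  dsimp only
  rcases le_or_gt 0 i with h | h
  · rw [Finset.Ico_eq_empty_of_le h, Finset.Ico_eq_empty_of_le (by omega : (0 : ℤ) ≤ i + 1),
      ← Finset.insert_Ico_right_eq_Ico_add_one h, Finset.sum_insert (by simp)]
    simp [add_comm]
  · rw [Finset.Ico_eq_empty_of_le h.le, Finset.Ico_eq_empty_of_le (by omega : i + 1 ≤ (0 : ℤ)),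
      ← Finset.insert_Ico_add_one_left_eq_Ico h, Finset.sum_insert (by simp)]
    simp

/-- The state of an edge, as an element of `ZMod 2`. -/
def edgeParity (η : Config) (e : Edge) : ZMod 2 := if η e = true then 1 else 0

/-- The state of the horizontal edge with left endpoint `(i, j)`. -/
def horizParity (η : Config) (i j : ℤ) : ZMod 2 := edgeParity η (incEdge (i, j) 0)

/-- The state of the vertical edge with lower endpoint `(i, j)`. -/
def vertParity (η : Config) (i j : ℤ) : ZMod 2 := edgeParity η (incEdge (i, j) 2)

lemma incEdge_one (i j : ℤ) : incEdge (i + 1, j) 1 = incEdge (i, j) 0 := by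
  apply Subtype.ext
  simp [incEdge, dir]

lemma incEdge_three (i j : ℤ) : incEdge (i, j + 1) 3 = incEdge (i, j) 2 := by
  apply Subtype.ext
  simp [incEdge, dir]

/-- The even degree condition at `(i + 1, j + 1)`, as an equation in `ZMod 2`. -/
lemma parity_sum_eq_zero {η : Config} (hη : η ∈ ΩEP) (i j : ℤ) :
    horizParity η (i + 1) (j + 1) + horizParity η i (j + 1) + vertParity η (i + 1) (j + 1)
      + vertParity η (i + 1) j = 0 := by
  have h := (ZMod.natCast_eq_zero_iff_even).2 (hη (i + 1, j + 1))
  rw [Finset.card_filter, Fin.sum_univ_four, incEdge_one, incEdge_three] at h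
  push_cast at h
  simpa [horizParity, vertParity, edgeParity] using h

/-- The edge parity of an even configuration is the gradient of a potential on dual sites. -/
lemma exists_potential {η : Config} (hη : η ∈ ΩEP) :
    ∃ H : ℤ → ℤ → ZMod 2, (∀ i j, H (i + 1) j = H i j + vertParity η (i + 1) j) ∧
      ∀ i j, H i (j + 1) = H i j + horizParity η i (j + 1) := by
  obtain ⟨A, -, hA⟩ := exists_discrete_antiderivative fun j => horizParity η 0 (j + 1)
  choose S hS0 hS using fun j => exists_discrete_antiderivative fun i => vertParity η (i + 1) j
  have h2 : (2 : ZMod 2) = 0 := rfl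
  refine ⟨fun i j => A j + S j i, fun i j => by simp only [hS, add_assoc], fun i j => ?_⟩
  have step : ∀ i, A (j + 1) + S (j + 1) (i + 1) - (A j + S j (i + 1) +
      horizParity η (i + 1) (j + 1)) = A (j + 1) + S (j + 1) i - (A j + S j i +
      horizParity η i (j + 1)) := fun i => by
    rw [hS, hS]
    linear_combination (vertParity η (i + 1) (j + 1) + horizParity η i (j + 1)) * h2 -
      parity_sum_eq_zero hη i j
  rw [← sub_eq_zero]
  induction i using Int.induction_on with
  | zero => simp [hA, hS0]
  | succ k ih => rw [step, ih]
  | pred k ih => rw [← step, sub_add_cancel, ih]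

lemma crossEdge_comm (a b : V) : crossEdge a b = crossEdge b a := by
  simp only [crossEdge, sup_comm a.1, sup_comm a.2, eq_comm (a := a.2)]

lemma edgeParity_crossEdge {η : Config} {H : ℤ → ℤ → ZMod 2}
    (hv : ∀ i j, H (i + 1) j = H i j + vertParity η (i + 1) j)
    (hh : ∀ i j, H i (j + 1) = H i j + horizParity η i (j + 1)) {a b : V} (hab : latAdj a b) :
    edgeParity η ⟨crossEdge a b, crossEdge_mem a b⟩ = H b.1 b.2 - H a.1 a.2 := by
  have right : ∀ i j, edgeParity η ⟨crossEdge (i, j) (i + 1, j), crossEdge_mem _ _⟩ =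
      H (i + 1) j - H i j := fun i j => by
    rw [hv, add_sub_cancel_left]
    congr 2
    simp [crossEdge, dir]
  have up : ∀ i j, edgeParity η ⟨crossEdge (i, j) (i, j + 1), crossEdge_mem _ _⟩ =
      H i (j + 1) - H i j := fun i j => by
    rw [hh, add_sub_cancel_left]
    congr 2
    simp [crossEdge, dir]
  obtain ⟨i, j⟩ := a
  obtain ⟨k, l⟩ := b
  have hstep : (k = i + 1 ∧ l = j) ∨ (i = k + 1 ∧ l = j) ∨ (k = i ∧ l = j + 1) ∨
      (k = i ∧ j = l + 1) := by
    simp only [latAdj] at hab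
    rcases abs_cases (i - k) with h | h <;> rcases abs_cases (j - l) with h' | h' <;> omega
  rcases hstep with ⟨rfl, rfl⟩ | ⟨rfl, rfl⟩ | ⟨rfl, rfl⟩ | ⟨rfl, rfl⟩
  · exact right _ _
  · simp only [crossEdge_comm (k + 1, l), right, CharTwo.sub_eq_add, add_comm]
  · exact up _ _
  · simp only [crossEdge_comm (k, l + 1), up, CharTwo.sub_eq_add, add_comm]

lemma Fin.sum_succ_sub_castSucc {G : Type*} [AddCommGroup G] {n : ℕ} (F : Fin (n + 1) → G) :
    ∑ i : Fin n, (F i.succ - F i.castSucc) = F (Fin.last n) - F 0 := by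
  have h := (Fin.sum_univ_succ F).symm.trans (Fin.sum_univ_castSucc F)
  rw [Finset.sum_sub_distrib, sub_eq_sub_iff_add_eq_add, add_comm, h, add_comm]

/-- The crossing parity of a dual path is the difference of the potential at its endpoints. -/
lemma crossCount_eq_sub {η : Config} {H : ℤ → ℤ → ZMod 2}
    (hv : ∀ i j, H (i + 1) j = H i j + vertParity η (i + 1) j)
    (hh : ∀ i j, H i (j + 1) = H i j + horizParity η i (j + 1))
    {n : ℕ} {γ : Fin (n + 1) → V} (hγ : ∀ i : Fin n, latAdj (γ i.castSucc) (γ i.succ)) :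
    (crossCount η n γ : ZMod 2) =
      H (γ (Fin.last n)).1 (γ (Fin.last n)).2 - H (γ 0).1 (γ 0).2 := by
  rw [← Fin.sum_succ_sub_castSucc fun i => H (γ i).1 (γ i).2, crossCount]
  push_cast
  exact Finset.sum_congr rfl fun i _ => edgeParity_crossEdge hv hh (hγ i)

/-- If `η` is an even configuration, then for any two nearest-neighbour dual paths with
the same endpoints, the numbers of `η`-open edges crossed by the two paths have the same
parity. -/
theorem even_config_crossing_parity (η : Config) (hη : η ∈ ΩEP)
    (n m : ℕ) (γ : Fin (n + 1) → V) (δ : Fin (m + 1) → V)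
    (hγ : ∀ i : Fin n, latAdj (γ i.castSucc) (γ i.succ))
    (hδ : ∀ i : Fin m, latAdj (δ i.castSucc) (δ i.succ))
    (h0 : γ 0 = δ 0) (h1 : γ (Fin.last n) = δ (Fin.last m)) :
    crossCount η n γ % 2 = crossCount η m δ % 2 := by
  obtain ⟨H, hv, hh⟩ := exists_potential hη
  refine (ZMod.natCast_eq_natCast_iff' _ _ 2).1 ?_
  rw [crossCount_eq_sub hv hh hγ, crossCount_eq_sub hv hh hδ, h0, h1]

end
end

section
/- Let σ ∈ {−1,+1}^{Z²_*}. If the contour configuration Γ(σ) contains an infinite self-avoiding nearest-neighbour path in Z² all of whose edges are open, then σ contains an infinite *-chain of spins +1 (an injective sequence (x_n) of dual sites with σ(x_n) = +1 and ‖x_{n+1} − x_n‖_∞ = 1 for all n), and likewise an infinite *-chain of spins −1. -/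
open MeasureTheory
open scoped BigOperators

noncomputable section

/-- Spin configurations on the dual lattice `ℤ²_* = (1/2,1/2) + ℤ²`, with dual sites
indexed by `ℤ²` (the index `u` stands for the dual point `u + (1/2,1/2)`);
`true` stands for spin `+1` and `false` for spin `-1`. -/
abbrev SpinConfig : Type := V → Bool

/-- The value `±1` of a spin. -/
def spinVal (b : Bool) : ℝ := if b then 1 else -1

/-- The two endpoints (in dual coordinates) of the dual edge `e_*` crossing the
primal edge `{x, y}`. -/
def dualSites (x y : V) : V × V :=
  let m : V := (x.1 ⊓ y.1, x.2 ⊓ y.2)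
  if x.2 = y.2 then (m, (m.1, m.2 - 1)) else (m, (m.1 - 1, m.2))

lemma dualSites_comm (x y : V) : dualSites x y = dualSites y x := by
  unfold dualSites
  by_cases h : x.2 = y.2
  · rw [if_pos h, if_pos h.symm]
    simp [inf_comm]
  · rw [if_neg h, if_neg (fun hh => h hh.symm)]
    simp [inf_comm]

def contourPair (σ : SpinConfig) (x y : V) : Bool :=
  σ (dualSites x y).1 != σ (dualSites x y).2

/-- The contour map `Γ`: the edge `e` is open in `Γ(σ)` iff the spins of `σ` at the two
endpoints of the dual edge `e_*` differ. -/
def contour (σ : SpinConfig) : Config :=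
  fun e => Sym2.lift ⟨fun x y => contourPair σ x y,
    fun x y => by simp only [contourPair, dualSites_comm]⟩ e.1

/-- `x` and `y` are joined by an open edge of `ω`. -/
def openAdj (ω : Config) (x y : V) : Prop :=
  ∃ h : s(x, y) ∈ E2, ω ⟨s(x, y), h⟩ = true

/-- `x` and `y` are connected by a path of open edges of `ω`. -/
def openConn (ω : Config) : V → V → Prop := Relation.ReflTransGen (openAdj ω)

/-- The cluster of `x` in `ω`: the connected component of `x` in the graph of open edges. -/
def cluster (ω : Config) (x : V) : Set V := {y | openConn ω x y}

/-- The configuration `ω` has an infinite cluster of open edges. -/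
def HasInfiniteCluster (ω : Config) : Prop := ∃ x : V, (cluster ω x).Infinite

/-- The percolation event `𝒞`: there exists an infinite open cluster. -/
def percEvent : Set Config := {ω | HasInfiniteCluster ω}

/-- `*`-adjacency on the dual lattice: `ℓ∞`-distance one. -/
def starAdj (x y : V) : Prop := max |x.1 - y.1| |x.2 - y.2| = 1

/-- The dual site `u` is one of the four dual sites surrounding the vertex `v`. -/
def IsDualCorner (v u : V) : Prop :=
  (v.1 - 1 ≤ u.1 ∧ u.1 ≤ v.1) ∧ (v.2 - 1 ≤ u.2 ∧ u.2 ≤ v.2)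

lemma IsDualCorner.eq_or_starAdj {v u w : V} (hu : IsDualCorner v u) (hw : IsDualCorner v w) :
    u = w ∨ starAdj u w := by
  obtain ⟨⟨_, _⟩, ⟨_, _⟩⟩ := hu
  obtain ⟨⟨_, _⟩, ⟨_, _⟩⟩ := hw
  simp only [starAdj, Prod.ext_iff, abs_eq_max_neg]
  omega

lemma finite_setOf_isDualCorner (u : V) : {v : V | IsDualCorner v u}.Finite := by
  refine ((Set.finite_Icc u.1 (u.1 + 1)).prod (Set.finite_Icc u.2 (u.2 + 1))).subset ?_
  rintro v ⟨⟨_, _⟩, ⟨_, _⟩⟩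
  simp only [Set.mem_prod, Set.mem_Icc]
  omega

lemma isDualCorner_dualSites_fst {x y : V} (h : latAdj x y) : IsDualCorner x (dualSites x y).1 := by
  simp only [latAdj, abs_eq_max_neg] at h
  unfold dualSites IsDualCorner
  split_ifs <;> dsimp only <;> omega

lemma isDualCorner_dualSites_snd {x y : V} (h : latAdj x y) : IsDualCorner x (dualSites x y).2 := by
  simp only [latAdj, abs_eq_max_neg] at h
  unfold dualSites IsDualCorner
  split_ifs <;> dsimp only <;> omega

lemma latAdj.symm {x y : V} (h : latAdj x y) : latAdj y x := by
  unfold latAdj at h ⊢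
  rwa [abs_sub_comm y.1, abs_sub_comm y.2]

/-- An open contour edge has a dual site of either spin next to it. -/
lemma exists_spin_isDualCorner_of_openAdj {σ : SpinConfig} {x y : V} (hadj : latAdj x y)
    (hopen : openAdj (contour σ) x y) (b : Bool) :
    ∃ u, σ u = b ∧ IsDualCorner x u ∧ IsDualCorner y u := by
  obtain ⟨_, hne⟩ := hopen
  replace hne : (σ (dualSites x y).1 != σ (dualSites x y).2) = true := hne
  have hfst := isDualCorner_dualSites_fst hadj.symm
  have hsnd := isDualCorner_dualSites_snd hadj.symm
  rw [dualSites_comm] at hfst hsnd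
  by_cases hb : σ (dualSites x y).1 = b
  · exact ⟨_, hb, isDualCorner_dualSites_fst hadj, hfst⟩
  · refine ⟨_, ?_, isDualCorner_dualSites_snd hadj, hsnd⟩
    revert hb hne
    cases σ (dualSites x y).1 <;> cases σ (dualSites x y).2 <;> cases b <;> decide

/-- Loop erasure: a sequence with finite fibres whose consecutive terms are equal or related
by `R` yields an injective sequence of its terms whose consecutive terms are related by `R`. -/
lemma exists_injective_chain_of_finite_fibers {α : Type*} {R : α → α → Prop} (p : ℕ → α)
    (hfin : ∀ a, {n | p n = a}.Finite) (hstep : ∀ n, p n = p (n + 1) ∨ R (p n) (p (n + 1))) :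
    ∃ s : ℕ → ℕ, Function.Injective (p ∘ s) ∧ ∀ k, R (p (s k)) (p (s (k + 1))) := by
  have hlast : ∀ n, ∃ l, p l = p n ∧ ∀ m, p m = p n → m ≤ l := fun n =>
    Set.exists_max_image {m | p m = p n} id (hfin _) ⟨n, rfl⟩
  choose l hl hmax using hlast
  let s : ℕ → ℕ := fun k => Nat.rec (l 0) (fun _ m => l (m + 1)) k
  have hs : ∀ k, s (k + 1) = l (s k + 1) := fun _ => rfl
  have hsmax : ∀ k m, p m = p (s k) → m ≤ s k := by
    rintro (_ | k) m hm
    · exact hmax 0 m (hm.trans (hl 0))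
    · exact hmax _ m (hm.trans (hl _))
  have hmono : StrictMono s := strictMono_nat_of_lt_succ fun k => by
    rw [hs]
    exact hmax (s k + 1) _ rfl
  refine ⟨s, fun i j hij => hmono.injective ?_, fun k => ?_⟩
  · exact le_antisymm (hsmax j _ hij) (hsmax i _ hij.symm)
  · rw [hs, hl]
    refine (hstep (s k)).resolve_left fun h => ?_
    exact absurd (hsmax k _ h.symm) (by omega)

/-- An infinite self-avoiding open contour path gives an infinite `*`-chain of either spin. -/
lemma exists_starChain_of_contour_path {σ : SpinConfig} {γ : ℕ → V}
    (hinj : Function.Injective γ) (hadj : ∀ n, latAdj (γ n) (γ (n + 1)))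
    (hopen : ∀ n, openAdj (contour σ) (γ n) (γ (n + 1))) (b : Bool) :
    ∃ x : ℕ → V, Function.Injective x ∧ (∀ n, σ (x n) = b) ∧
      ∀ n, starAdj (x n) (x (n + 1)) := by
  choose p hp hleft hright using
    fun n => exists_spin_isDualCorner_of_openAdj (hadj n) (hopen n) b
  have hfin : ∀ u, {n | p n = u}.Finite := fun u =>
    ((finite_setOf_isDualCorner u).preimage hinj.injOn).subset fun n (hn : p n = u) => hn ▸ hleft n
  obtain ⟨s, hsinj, hstar⟩ := exists_injective_chain_of_finite_fibers p hfin
    fun n => (hright n).eq_or_starAdj (hleft (n + 1))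
  exact ⟨p ∘ s, hsinj, fun n => hp (s n), hstar⟩

/-- If the contours of `σ` contain an infinite self-avoiding open path, then `σ`
contains an infinite `*`-chain of spins `+1` and an infinite `*`-chain of spins `-1`. -/
theorem infinite_contour_path_gives_star_chains (σ : SpinConfig)
    (γ : ℕ → V) (hinj : Function.Injective γ)
    (hadj : ∀ n : ℕ, latAdj (γ n) (γ (n + 1)))
    (hopen : ∀ n : ℕ, openAdj (contour σ) (γ n) (γ (n + 1))) :
    (∃ x : ℕ → V, Function.Injective x ∧ (∀ n, σ (x n) = true) ∧
      ∀ n, starAdj (x n) (x (n + 1))) ∧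
    (∃ x : ℕ → V, Function.Injective x ∧ (∀ n, σ (x n) = false) ∧
      ∀ n, starAdj (x n) (x (n + 1))) := by
  exact ⟨exists_starChain_of_contour_path hinj hadj hopen true,
    exists_starChain_of_contour_path hinj hadj hopen false⟩

end
end

section
/- Let G = (V,E) be the finite Eulerian graph with vertices {e₀, f₀, e₁, f₁, e₂, f₂, e₃, f₃} and the 10 edges {e₀,f₀} and, for each i ∈ {1,2,3}, {e₀,e_i}, {e_i,f_i}, {f_i,f₀}. For every increasing event A ⊆ {0,1}^{E}, the map p ↦ μ_{p,G}(A) is non-decreasing on [0,1]; equivalently, for every non-decreasing (monotone) function F : {0,1}^{E} → ℝ, the map p ↦ ∫ F dμ_{p,G} is non-decreasing. -/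
open scoped BigOperators

noncomputable section

/-- The 8 vertices of the graph `G`: `0 = e₀`, `1 = f₀`, and for `i ∈ {1,2,3}`,
`2i = e_i` and `2i+1 = f_i`. -/
abbrev GVert : Type := Fin 8

/-- The 10 edges of the Eulerian graph `G`: the edge `{e₀,f₀}` and, for each
`i ∈ {1,2,3}`, the three edges `{e₀,e_i}`, `{e_i,f_i}`, `{f_i,f₀}`. -/
def gEdges : Fin 10 → GVert × GVert :=
  ![(0, 1), (0, 2), (2, 3), (3, 1), (0, 4), (4, 5), (5, 1), (0, 6), (6, 7), (7, 1)]

/-- An edge configuration on `G`. -/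
abbrev GConfig : Type := Fin 10 → Bool

/-- The degree of the vertex `v` in the subgraph of open edges of `ω`. -/
def gDeg (ω : GConfig) (v : GVert) : ℕ :=
  (Finset.univ.filter
    (fun i : Fin 10 => ((gEdges i).1 = v ∨ (gEdges i).2 = v) ∧ ω i = true)).card

/-- The subgraph of open edges of `ω` is even (Eulerian). -/
def gEven (ω : GConfig) : Prop := ∀ v : GVert, Even (gDeg ω v)

open Classical in
/-- The Bernoulli(`p`) weight of `ω`, restricted to even configurations. -/
def gWeight (p : ℝ) (ω : GConfig) : ℝ :=
  (∏ i : Fin 10, if ω i then p else 1 - p) * (if gEven ω then 1 else 0)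

open Classical in
/-- The probability of `A` under Eulerian percolation `μ_{p,G}` on `G`: Bernoulli(`p`)
bond percolation conditioned on the subgraph of open edges being even. -/
def gProb (p : ℝ) (A : Set GConfig) : ℝ :=
  (∑ ω : GConfig, if ω ∈ A then gWeight p ω else 0) / (∑ ω : GConfig, gWeight p ω)

/-- The expectation of `F` under Eulerian percolation `μ_{p,G}` on `G`. -/
def gExp (p : ℝ) (F : GConfig → ℝ) : ℝ :=
  (∑ ω : GConfig, F ω * gWeight p ω) / (∑ ω : GConfig, gWeight p ω)


/-- The even configuration of `G` in which the three paths `e₀ e_i f_i f₀` have states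
`a`, `b`, `c`. -/
def evenConfig (x : Bool × Bool × Bool) : GConfig :=
  ![xor x.1 (xor x.2.1 x.2.2), x.1, x.1, x.1, x.2.1, x.2.1, x.2.1, x.2.2, x.2.2, x.2.2]

theorem evenConfig_injective : Function.Injective evenConfig := by
  rintro ⟨a, b, c⟩ ⟨a', b', c'⟩ h
  have h1 := congrFun h 1
  have h4 := congrFun h 4
  have h7 := congrFun h 7
  simp_all [evenConfig]

theorem gEven_evenConfig (x : Bool × Bool × Bool) : gEven (evenConfig x) := by
  revert x
  unfold gEven gDeg
  decide +kernel

theorem eq_evenConfig_of_gEven {ω : GConfig} (h : gEven ω) :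
    ω = evenConfig (ω 1, ω 4, ω 7) := by
  revert ω
  unfold gEven gDeg
  decide +kernel

theorem sum_mul_gWeight (p : ℝ) (F : GConfig → ℝ) :
    ∑ ω, F ω * gWeight p ω =
      ∑ x, F (evenConfig x) * ∏ i, if evenConfig x i then p else 1 - p := by
  symm
  refine Fintype.sum_of_injective evenConfig evenConfig_injective _ _ ?_ ?_
  · intro ω hω
    have : ¬ gEven ω := fun h => hω ⟨_, (eq_evenConfig_of_gEven h).symm⟩
    simp [gWeight, this]
  · intro x
    simp [gWeight, gEven_evenConfig]

/-- The sum of the values of `F` at the three cycles of length 4. -/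
def sumFour (F : GConfig → ℝ) : ℝ :=
  F (evenConfig (true, false, false)) + F (evenConfig (false, true, false)) +
    F (evenConfig (false, false, true))

/-- The sum of the values of `F` at the three cycles of length 6. -/
def sumSix (F : GConfig → ℝ) : ℝ :=
  F (evenConfig (true, true, false)) + F (evenConfig (true, false, true)) +
    F (evenConfig (false, true, true))

/-- The numerator of `gExp` in terms of the values of `F` on even configurations. -/
theorem sum_mul_gWeight_eq (p : ℝ) (F : GConfig → ℝ) :
    ∑ ω, F ω * gWeight p ω =
      F ⊥ * (1 - p) ^ 10 + sumFour F * (p ^ 4 * (1 - p) ^ 6) +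
        sumSix F * (p ^ 6 * (1 - p) ^ 4) + F ⊤ * p ^ 10 := by
  have hbot : evenConfig (false, false, false) = ⊥ := by decide
  have htop : evenConfig (true, true, true) = ⊤ := by decide
  rw [sum_mul_gWeight, ← hbot, ← htop]
  simp only [Fintype.sum_prod_type, Fintype.sum_bool, sumFour, sumSix]
  simp [Fin.prod_univ_succ, evenConfig]
  ring

theorem sum_gWeight_eq (p : ℝ) :
    ∑ ω, gWeight p ω =
      (1 - p) ^ 10 + 3 * (p ^ 4 * (1 - p) ^ 6) + 3 * (p ^ 6 * (1 - p) ^ 4) + p ^ 10 := by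
  have h := sum_mul_gWeight_eq p (fun _ => 1)
  simp only [one_mul, sumFour, sumSix] at h
  rw [h]
  ring

theorem sum_gWeight_pos {p : ℝ} (h0 : 0 ≤ p) (h1 : p ≤ 1) : 0 < ∑ ω, gWeight p ω := by
  rw [sum_gWeight_eq]
  have hq : 0 ≤ 1 - p := by linarith
  rcases h0.eq_or_lt with rfl | hp
  · norm_num
  · positivity

theorem nine_mul_sq_mul_sq_le {a b X Y : ℝ} (ha : 0 ≤ a) (hb : 0 ≤ b) (hX : 0 ≤ X) (hY : 0 ≤ Y)
    (hab : a * b = X * Y) :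
    9 * (X ^ 2 * Y ^ 2) ≤ 3 * (a ^ 3 + b ^ 3) * (X + Y) +
      (X ^ 4 + X ^ 3 * Y + X ^ 2 * Y ^ 2 + X * Y ^ 3 + Y ^ 4) := by
  have hXY : 0 ≤ X * Y := mul_nonneg hX hY
  have hcube : X * Y * (a + b) ≤ a ^ 3 + b ^ 3 := by
    rw [← hab]
    nlinarith [mul_nonneg (add_nonneg ha hb) (sq_nonneg (a - b))]
  have hprod : 4 * (X * Y) ≤ (a + b) * (X + Y) := by
    refine le_of_sq_le_sq ?_ (by positivity)
    have h1 : 4 * (X * Y) ≤ (X + Y) ^ 2 := by nlinarith [sq_nonneg (X - Y)]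
    have h2 : 4 * (X * Y) ≤ (a + b) ^ 2 := by nlinarith [sq_nonneg (a - b)]
    calc (4 * (X * Y)) ^ 2 = 4 * (X * Y) * (4 * (X * Y)) := by ring
      _ ≤ (a + b) ^ 2 * (X + Y) ^ 2 := by gcongr
      _ = ((a + b) * (X + Y)) ^ 2 := by ring
  have h1 := mul_le_mul_of_nonneg_right hcube (add_nonneg hX hY)
  have h2 := mul_le_mul_of_nonneg_left hprod hXY
  have h3 : 0 ≤ X ^ 4 + X ^ 3 * Y + X * Y ^ 3 + Y ^ 4 := by positivity
  have h4 : 0 ≤ X ^ 2 * Y ^ 2 := by positivity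
  nlinarith

/-- An affine function of two variables that is nonnegative at the vertices of the square
`[0, 3]²` is nonnegative on the square, in homogeneous form. -/
theorem affine_nonneg_of_vertices {α β γ A B C : ℝ} (hA : 0 ≤ A) (hAC : A ≤ 3 * C)
    (hB : 0 ≤ B) (hBC : B ≤ 3 * C) (h00 : 0 ≤ γ) (h10 : 0 ≤ 3 * α + γ) (h01 : 0 ≤ 3 * β + γ)
    (h11 : 0 ≤ 3 * α + 3 * β + γ) : 0 ≤ A * α + B * β + C * γ := by
  rcases le_total 0 α with hα | hα <;> rcases le_total 0 β with hβ | hβ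
  · have : 0 ≤ C := by linarith
    positivity
  · nlinarith [mul_nonneg hA hα]
  · nlinarith [mul_nonneg hB hβ]
  · nlinarith

theorem gExp_mono {F : GConfig → ℝ} (hF : Monotone F) {p₁ p₂ : ℝ} (h₁ : 0 ≤ p₁) (h : p₁ ≤ p₂)
    (h₂ : p₂ ≤ 1) : gExp p₁ F ≤ gExp p₂ F := by
  unfold gExp
  rw [div_le_div_iff₀ (sum_gWeight_pos h₁ (h.trans h₂)) (sum_gWeight_pos (h₁.trans h) h₂)]
  simp only [sum_mul_gWeight_eq, sum_gWeight_eq]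
  have hbot (ω) : F ⊥ ≤ F ω := hF bot_le
  have htop (ω) : F ω ≤ F ⊤ := hF le_top
  have hA0 : 0 ≤ sumFour F - 3 * F ⊥ := by
    unfold sumFour
    linarith [hbot (evenConfig (true, false, false)), hbot (evenConfig (false, true, false)),
      hbot (evenConfig (false, false, true))]
  have hA1 : sumFour F - 3 * F ⊥ ≤ 3 * (F ⊤ - F ⊥) := by
    unfold sumFour
    linarith [htop (evenConfig (true, false, false)), htop (evenConfig (false, true, false)),
      htop (evenConfig (false, false, true))]
  have hB0 : 0 ≤ sumSix F - 3 * F ⊥ := by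
    unfold sumSix
    linarith [hbot (evenConfig (true, true, false)), hbot (evenConfig (true, false, true)),
      hbot (evenConfig (false, true, true))]
  have hB1 : sumSix F - 3 * F ⊥ ≤ 3 * (F ⊤ - F ⊥) := by
    unfold sumSix
    linarith [htop (evenConfig (true, true, false)), htop (evenConfig (true, false, true)),
      htop (evenConfig (false, true, true))]
  have hq₁ : 0 ≤ 1 - p₁ := by linarith
  have hq₂ : 0 ≤ 1 - p₂ := by linarith
  have hp₂ : 0 ≤ p₂ := h₁.trans h
  have hX : 0 ≤ (p₂ * (1 - p₁)) ^ 2 := by positivity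
  have hY : 0 ≤ (p₁ * (1 - p₂)) ^ 2 := by positivity
  have ha : 0 ≤ ((1 - p₁) * (1 - p₂)) ^ 2 := by positivity
  have hb : 0 ≤ (p₁ * p₂) ^ 2 := by positivity
  have hYX : (p₁ * (1 - p₂)) ^ 2 ≤ (p₂ * (1 - p₁)) ^ 2 := by
    gcongr
  generalize 1 - p₁ = q₁ at *
  generalize 1 - p₂ = q₂ at *
  have hab : (q₁ * q₂) ^ 2 * (p₁ * p₂) ^ 2 = (p₂ * q₁) ^ 2 * (p₁ * q₂) ^ 2 := by ring
  have key := nine_mul_sq_mul_sq_le ha hb hX hY hab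
  have m40 : 0 ≤ p₂ ^ 4 * q₂ ^ 6 * q₁ ^ 10 - p₁ ^ 4 * q₁ ^ 6 * q₂ ^ 10 := by
    have := mul_nonneg (pow_nonneg ha 3) (sub_nonneg.2 (pow_le_pow_left₀ hY hYX 2))
    linear_combination this
  have m60 : 0 ≤ p₂ ^ 6 * q₂ ^ 4 * q₁ ^ 10 - p₁ ^ 6 * q₁ ^ 4 * q₂ ^ 10 := by
    have := mul_nonneg (pow_nonneg ha 2) (sub_nonneg.2 (pow_le_pow_left₀ hY hYX 3))
    linear_combination this
  have m100 : 0 ≤ p₂ ^ 10 * q₁ ^ 10 - p₁ ^ 10 * q₂ ^ 10 := by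
    have := sub_nonneg.2 (pow_le_pow_left₀ hY hYX 5)
    linear_combination this
  have m64 : 0 ≤ p₂ ^ 6 * q₂ ^ 4 * (p₁ ^ 4 * q₁ ^ 6) - p₁ ^ 6 * q₁ ^ 4 * (p₂ ^ 4 * q₂ ^ 6) := by
    have := mul_nonneg (mul_nonneg (pow_nonneg ha 2) (pow_nonneg hb 2)) (sub_nonneg.2 hYX)
    linear_combination this
  have m104 : 0 ≤ p₂ ^ 10 * (p₁ ^ 4 * q₁ ^ 6) - p₁ ^ 10 * (p₂ ^ 4 * q₂ ^ 6) := by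
    have := mul_nonneg (pow_nonneg hb 2) (sub_nonneg.2 (pow_le_pow_left₀ hY hYX 3))
    linear_combination this
  have m106 : 0 ≤ p₂ ^ 10 * (p₁ ^ 6 * q₁ ^ 4) - p₁ ^ 10 * (p₂ ^ 6 * q₂ ^ 4) := by
    have := mul_nonneg (pow_nonneg hb 3) (sub_nonneg.2 (pow_le_pow_left₀ hY hYX 2))
    linear_combination this
  have hard := mul_nonneg (sub_nonneg.2 hYX) (sub_nonneg.2 key)
  have main := affine_nonneg_of_vertices hA0 hA1 hB0 hB1
    (α := p₂ ^ 4 * q₂ ^ 6 * (q₁ ^ 10 + 3 * (p₁ ^ 4 * q₁ ^ 6) + 3 * (p₁ ^ 6 * q₁ ^ 4) + p₁ ^ 10) -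
      p₁ ^ 4 * q₁ ^ 6 * (q₂ ^ 10 + 3 * (p₂ ^ 4 * q₂ ^ 6) + 3 * (p₂ ^ 6 * q₂ ^ 4) + p₂ ^ 10))
    (β := p₂ ^ 6 * q₂ ^ 4 * (q₁ ^ 10 + 3 * (p₁ ^ 4 * q₁ ^ 6) + 3 * (p₁ ^ 6 * q₁ ^ 4) + p₁ ^ 10) -
      p₁ ^ 6 * q₁ ^ 4 * (q₂ ^ 10 + 3 * (p₂ ^ 4 * q₂ ^ 6) + 3 * (p₂ ^ 6 * q₂ ^ 4) + p₂ ^ 10))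
    (γ := p₂ ^ 10 * (q₁ ^ 10 + 3 * (p₁ ^ 4 * q₁ ^ 6) + 3 * (p₁ ^ 6 * q₁ ^ 4) + p₁ ^ 10) -
      p₁ ^ 10 * (q₂ ^ 10 + 3 * (p₂ ^ 4 * q₂ ^ 6) + 3 * (p₂ ^ 6 * q₂ ^ 4) + p₂ ^ 10))
    (by linear_combination m100 + 3 * m104 + 3 * m106)
    (by linear_combination hard)
    (by linear_combination 3 * m60 + 9 * m64 + m100 + 3 * m104)
    (by linear_combination 3 * m40 + 3 * m60 + m100)
  linear_combination main

/-- On the Eulerian graph `G`, Eulerian percolation is stochastically monotone in `p`: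
for every increasing event `A`, `p ↦ μ_{p,G}(A)` is non-decreasing on `[0,1]`;
equivalently, for every non-decreasing function `F`, `p ↦ ∫ F dμ_{p,G}` is
non-decreasing on `[0,1]`. -/
theorem gEulerian_monotone :
    (∀ A : Set GConfig, (∀ ω ω' : GConfig, ω ∈ A → ω ≤ ω' → ω' ∈ A) →
      ∀ p₁ p₂ : ℝ, 0 ≤ p₁ → p₁ ≤ p₂ → p₂ ≤ 1 → gProb p₁ A ≤ gProb p₂ A) ∧
    (∀ F : GConfig → ℝ, Monotone F →
      ∀ p₁ p₂ : ℝ, 0 ≤ p₁ → p₁ ≤ p₂ → p₂ ≤ 1 → gExp p₁ F ≤ gExp p₂ F) := by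
  classical
  refine ⟨fun A hA p₁ p₂ h₁ h h₂ => ?_, fun F hF p₁ p₂ h₁ h h₂ => gExp_mono hF h₁ h h₂⟩
  have hF : Monotone (A.indicator (1 : GConfig → ℝ)) := by
    intro ω ω' hω
    by_cases hωA : ω ∈ A
    · simp [hωA, hA ω ω' hωA hω]
    · rw [Set.indicator_of_notMem hωA]
      exact Set.indicator_nonneg (fun _ _ => zero_le_one) ω'
  have hprob (p : ℝ) : gProb p A = gExp p (A.indicator 1) := by
    simp [gProb, gExp, Set.indicator_apply, ite_mul]
  rw [hprob, hprob]
  exact gExp_mono hF h₁ h h₂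

end
end

section
/- Let G be the finite Eulerian graph with vertices {e₀, f₀, e₁, f₁, e₂, f₂, e₃, f₃} and edges {e₀,f₀} and, for i ∈ {1,2,3}, {e₀,e_i}, {e_i,f_i}, {f_i,f₀}. For p ∈ (0,1) set q = p/(1−p), Z(q) = 1 + 3q⁴ + 3q⁶ + q¹⁰, and let C_i = {X₀ = X_i = 1} for i ∈ {1,2,3}. Then μ_{p,G}(C₁ ∩ C₂) − μ_{p,G}(C₁)·μ_{p,G}(C₂) = (−q⁸ + q¹⁰ + q¹⁴ + 3q¹⁶)/Z(q)², and this quantity is strictly negative whenever 0 < q ≤ 0.74: the increasing events C₁ and C₂ are negatively correlated under μ_{p,G} for such p, so Eulerian percolation on G does not satisfy the FKG (positive association) inequality. -/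
open scoped BigOperators

noncomputable section

/-- `X_i` is the indicator that the edge `{e_i, f_i}` is open: edge `0` for `i = 0`,
edge `2` for `i = 1`, edge `5` for `i = 2`, edge `8` for `i = 3`. -/
def gC1 : Set GConfig := {ω | ω 0 = true ∧ ω 2 = true}

def gC2 : Set GConfig := {ω | ω 0 = true ∧ ω 5 = true}

def Zq (q : ℝ) : ℝ := 1 + 3 * q ^ 4 + 3 * q ^ 6 + q ^ 10

/-- The even configuration of `G` whose three paths from `e₀` to `f₀` are open according to
the given bits, the state of the edge `{e₀,f₀}` being forced by parity. -/
def pathConfig (a : Bool × Bool × Bool) : GConfig :=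
  ![a.1 ^^ a.2.1 ^^ a.2.2, a.1, a.1, a.1, a.2.1, a.2.1, a.2.1, a.2.2, a.2.2, a.2.2]

theorem pathConfig_injective : Function.Injective pathConfig := by
  rintro ⟨a, b, c⟩ ⟨a', b', c'⟩ h
  have h1 := congrFun h 1
  have h2 := congrFun h 4
  have h3 := congrFun h 7
  simp only [Prod.mk.injEq]
  exact ⟨h1, h2, h3⟩

theorem gDeg_eq_sum (ω : GConfig) (v : GVert) :
    gDeg ω v = ∑ i : Fin 10,
      if ((gEdges i).1 = v ∨ (gEdges i).2 = v) ∧ ω i = true then 1 else 0 := by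
  rw [gDeg, Finset.card_filter]

theorem gEven_pathConfig (a : Bool × Bool × Bool) : gEven (pathConfig a) := by
  intro v
  rw [gDeg_eq_sum]
  revert a v
  decide

theorem bool_eq_of_even_add {a b : Bool}
    (h : Even ((if a = true then 1 else 0) + if b = true then 1 else 0)) : a = b := by
  revert a b h
  decide

theorem bool_eq_xor_of_even_add {a b c d : Bool}
    (h : Even ((if a = true then 1 else 0) + ((if b = true then 1 else 0) +
      ((if c = true then 1 else 0) + if d = true then 1 else 0)))) :
    a = (b ^^ c ^^ d) := by
  revert a b c d h
  decide

theorem gEven.mem_range_pathConfig {ω : GConfig} (h : gEven ω) : ω ∈ Set.range pathConfig := by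
  have h0 : ω 0 = (ω 1 ^^ ω 4 ^^ ω 7) := bool_eq_xor_of_even_add <| by
    simpa [gDeg_eq_sum, Fin.sum_univ_succ, gEdges, -Finset.sum_boole] using h 0
  have h2 : ω 1 = ω 2 := bool_eq_of_even_add <| by
    simpa [gDeg_eq_sum, Fin.sum_univ_succ, gEdges, -Finset.sum_boole] using h 2
  have h3 : ω 2 = ω 3 := bool_eq_of_even_add <| by
    simpa [gDeg_eq_sum, Fin.sum_univ_succ, gEdges, -Finset.sum_boole] using h 3
  have h4 : ω 4 = ω 5 := bool_eq_of_even_add <| by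
    simpa [gDeg_eq_sum, Fin.sum_univ_succ, gEdges, -Finset.sum_boole] using h 4
  have h5 : ω 5 = ω 6 := bool_eq_of_even_add <| by
    simpa [gDeg_eq_sum, Fin.sum_univ_succ, gEdges, -Finset.sum_boole] using h 5
  have h6 : ω 7 = ω 8 := bool_eq_of_even_add <| by
    simpa [gDeg_eq_sum, Fin.sum_univ_succ, gEdges, -Finset.sum_boole] using h 6
  have h7 : ω 8 = ω 9 := bool_eq_of_even_add <| by
    simpa [gDeg_eq_sum, Fin.sum_univ_succ, gEdges, -Finset.sum_boole] using h 7
  refine ⟨(ω 1, ω 4, ω 7), funext fun i => ?_⟩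
  fin_cases i
  exacts [h0.symm, rfl, h2, h2.trans h3, rfl, h4, h4.trans h5, rfl, h6, h6.trans h7]

theorem gWeight_eq_zero_of_notMem_range (p : ℝ) {ω : GConfig} (h : ω ∉ Set.range pathConfig) :
    gWeight p ω = 0 := by
  rw [gWeight, if_neg fun he => h he.mem_range_pathConfig, mul_zero]

theorem gWeight_pathConfig (p : ℝ) (a : Bool × Bool × Bool) :
    gWeight p (pathConfig a) = ∏ i : Fin 10, if pathConfig a i then p else 1 - p := by
  rw [gWeight, if_pos (gEven_pathConfig a), mul_one]

open Classical in
theorem gProb_eq_sum_pathConfig (p : ℝ) (A : Set GConfig) :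
    gProb p A =
      (∑ a, if pathConfig a ∈ A then gWeight p (pathConfig a) else 0) /
        ∑ a, gWeight p (pathConfig a) := by
  rw [gProb]
  congr 1 <;> symm <;> refine Fintype.sum_of_injective _ pathConfig_injective _ _ ?_ fun _ => rfl
  · intro ω h
    simp [gWeight_eq_zero_of_notMem_range p h]
  · intro ω h
    exact gWeight_eq_zero_of_notMem_range p h

theorem prod_bernoulli_eq_mul_prod_odds {p : ℝ} (hp1 : p < 1) (ω : GConfig) :
    (∏ i : Fin 10, if ω i then p else 1 - p) =
      (1 - p) ^ 10 * ∏ i : Fin 10, if ω i then p / (1 - p) else 1 := by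
  have h : 1 - p ≠ 0 := by linarith
  rw [← Fin.prod_const 10 (1 - p), ← Finset.prod_mul_distrib]
  refine Finset.prod_congr rfl fun i _ => ?_
  split_ifs
  · field_simp
  · simp

theorem sum_gWeight_pathConfig {p : ℝ} (hp1 : p < 1) :
    ∑ a, gWeight p (pathConfig a) = (1 - p) ^ 10 * Zq (p / (1 - p)) := by
  simp only [gWeight_pathConfig, prod_bernoulli_eq_mul_prod_odds hp1, ← Finset.mul_sum]
  congr 1
  simp [Fintype.sum_prod_type, Fin.prod_univ_succ, pathConfig, Zq]
  ring

theorem Zq_pos {q : ℝ} (hq : 0 < q) : 0 < Zq q := by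
  unfold Zq
  positivity

open Classical in
theorem gProb_eq_sum_div_Zq {p : ℝ} (hp1 : p < 1) (A : Set GConfig) :
    gProb p A =
      (∑ a, if pathConfig a ∈ A then ∏ i : Fin 10, if pathConfig a i then p / (1 - p) else 1
        else 0) / Zq (p / (1 - p)) := by
  have h : (1 - p) ^ 10 ≠ 0 := pow_ne_zero _ (by linarith)
  rw [gProb_eq_sum_pathConfig, sum_gWeight_pathConfig hp1]
  simp only [gWeight_pathConfig, prod_bernoulli_eq_mul_prod_odds hp1, ← mul_ite_zero,
    ← Finset.mul_sum]
  exact mul_div_mul_left _ _ h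

theorem gProb_gC1 {p : ℝ} (hp1 : p < 1) :
    gProb p gC1 = ((p / (1 - p)) ^ 4 + (p / (1 - p)) ^ 10) / Zq (p / (1 - p)) := by
  rw [gProb_eq_sum_div_Zq hp1]
  congr 1
  simp [Fintype.sum_prod_type, Fin.prod_univ_succ, pathConfig, gC1]
  ring

theorem gProb_gC2 {p : ℝ} (hp1 : p < 1) :
    gProb p gC2 = ((p / (1 - p)) ^ 4 + (p / (1 - p)) ^ 10) / Zq (p / (1 - p)) := by
  rw [gProb_eq_sum_div_Zq hp1]
  congr 1
  simp [Fintype.sum_prod_type, Fin.prod_univ_succ, pathConfig, gC2]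
  ring

theorem gProb_gC1_inter_gC2 {p : ℝ} (hp1 : p < 1) :
    gProb p (gC1 ∩ gC2) = (p / (1 - p)) ^ 10 / Zq (p / (1 - p)) := by
  rw [gProb_eq_sum_div_Zq hp1]
  congr 1
  simp [Fintype.sum_prod_type, Fin.prod_univ_succ, pathConfig, gC1, gC2]
  ring

theorem covariance_numerator_neg {q : ℝ} (hq0 : 0 < q) (hq : q ≤ 0.74) :
    -q ^ 8 + q ^ 10 + q ^ 14 + 3 * q ^ 16 < 0 := by
  have h2 : q ^ 2 ≤ 0.74 ^ 2 := by gcongr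
  have h6 : q ^ 6 ≤ 0.74 ^ 6 := by gcongr
  have h8 : q ^ 8 ≤ 0.74 ^ 8 := by gcongr
  have h : -1 + q ^ 2 + q ^ 6 + 3 * q ^ 8 < 0 := by
    norm_num at h2 h6 h8 ⊢
    linarith
  calc -q ^ 8 + q ^ 10 + q ^ 14 + 3 * q ^ 16
      = q ^ 8 * (-1 + q ^ 2 + q ^ 6 + 3 * q ^ 8) := by ring
    _ < 0 := mul_neg_of_pos_of_neg (by positivity) h

/-- On the Eulerian graph `G`, the increasing events `C₁ = {X₀ = X₁ = 1}` and
`C₂ = {X₀ = X₂ = 1}` satisfy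
`μ_{p,G}(C₁ ∩ C₂) - μ_{p,G}(C₁) μ_{p,G}(C₂) = (-q⁸+q¹⁰+q¹⁴+3q¹⁶)/Z(q)²` with
`q = p/(1-p)`, a quantity which is negative whenever `0 < q ≤ 0.74`: Eulerian
percolation on `G` does not satisfy positive association (FKG). -/
theorem gEulerian_negative_correlation (p : ℝ) (hp0 : 0 < p) (hp1 : p < 1)
    (q : ℝ) (hq : q = p / (1 - p)) :
    gProb p (gC1 ∩ gC2) - gProb p gC1 * gProb p gC2 =
      (-q ^ 8 + q ^ 10 + q ^ 14 + 3 * q ^ 16) / Zq q ^ 2 ∧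
    (q ≤ 0.74 → gProb p (gC1 ∩ gC2) - gProb p gC1 * gProb p gC2 < 0) := by
  have hq0 : 0 < q := hq ▸ div_pos hp0 (sub_pos.mpr hp1)
  have hZ := Zq_pos hq0
  have key : gProb p (gC1 ∩ gC2) - gProb p gC1 * gProb p gC2 =
      (-q ^ 8 + q ^ 10 + q ^ 14 + 3 * q ^ 16) / Zq q ^ 2 := by
    rw [gProb_gC1_inter_gC2 hp1, gProb_gC1 hp1, gProb_gC2 hp1, ← hq]
    field_simp
    rw [Zq]
    ring
  refine ⟨key, fun hq' => ?_⟩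
  rw [key]
  exact div_neg_of_neg_of_pos (covariance_numerator_neg hq0 hq') (by positivity)

end
end
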